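/- arXiv:2410.06778 — 3 statements merged into one kernel-verified Lean document; each statement's English description precedes it below -/
import Mathlib

section
/- Let (S1, phi1) and (S2, phi2) be irreducibly quantified interactions, and let *1 in S1 and *2 in S2. Then the wedge sum interaction (S1 v S2, phi1 v phi2) along *1 and *2 is irreducibly quantified. -/
open Relation

universe u

/-- An interaction on `S`: a symmetric set of directed edges on the vertex set `S × S`. -/
def IsInteraction {S : Type*} (φ : Set ((S × S) × (S × S))) : Prop :=
  ∀ p ∈ φ, (p.2, p.1) ∈ φ

/-- A conserved quantity for the interaction `φ`. -/
def IsConserved {S : Type*} (φ : Set ((S × S) × (S × S))) (ξ : S → ℝ) : Prop :=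
  ∀ p ∈ φ, ξ p.1.1 + ξ p.1.2 = ξ p.2.1 + ξ p.2.2

/-- `ξ_S (s1, s2) = ξ s1 + ξ s2`. -/
def pairSum {S : Type*} (ξ : S → ℝ) (p : S × S) : ℝ := ξ p.1 + ξ p.2

/-- A symmetric directed graph structure on `X` given by its set of edges. -/
def IsSymmGraph {X : Type*} (E : Set (X × X)) : Prop := ∀ p ∈ E, (p.2, p.1) ∈ E

/-- Two vertices lie in the same connected component of the graph with edge set `E`. -/
def graphConn {X : Type*} (E : Set (X × X)) : X → X → Prop :=
  Relation.ReflTransGen (fun a b => (a, b) ∈ E)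

/-- A constant real-valued function. -/
def IsConstFn {S : Type*} (ξ : S → ℝ) : Prop := ∀ a b, ξ a = ξ b

/-- The submodule of `S → ℝ` consisting of conserved quantities of `φ`. -/
def consvSubmodule {S : Type*} (φ : Set ((S × S) × (S × S))) : Submodule ℝ (S → ℝ) where
  carrier := {ξ | IsConserved φ ξ}
  add_mem' := by
    intro a b ha hb p hp
    have h1 := ha p hp
    have h2 := hb p hp
    simp only [Pi.add_apply]
    linarith
  zero_mem' := by
    intro p hp
    simp
  smul_mem' := by
    intro c a ha p hp
    simp only [Pi.smul_apply, smul_eq_mul]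
    rw [← mul_add, ← mul_add, ha p hp]

/-- The submodule of constant functions. -/
def constSubmodule (S : Type*) : Submodule ℝ (S → ℝ) where
  carrier := {ξ | IsConstFn ξ}
  add_mem' := by
    intro a b ha hb x y
    simp only [Pi.add_apply]
    rw [ha x y, hb x y]
  zero_mem' := by intro x y; rfl
  smul_mem' := by
    intro c a ha x y
    simp only [Pi.smul_apply]
    rw [ha x y]

/-- `Consv^φ(S)`: conserved quantities modulo constant functions. -/
abbrev ConsvQuot {S : Type*} (φ : Set ((S × S) × (S × S))) :=
  (consvSubmodule φ) ⧸ ((constSubmodule S).comap (consvSubmodule φ).subtype)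

/-- `c_φ`, the dimension of `Consv^φ(S)`. -/
noncomputable def cdim {S : Type*} (φ : Set ((S × S) × (S × S))) : ℕ :=
  Module.finrank ℝ (ConsvQuot φ)

/-- Equivalence of interactions: a bijection of the sets of local states whose pullback
induces an isomorphism of the spaces of conserved quantities modulo constants. -/
def InteractionEquiv {S : Type*} {S' : Type*} (φ : Set ((S × S) × (S × S)))
    (φ' : Set ((S' × S') × (S' × S'))) : Prop :=
  ∃ e : S ≃ S',
    (∀ ξ : S' → ℝ, IsConserved φ' ξ → IsConserved φ (fun s => ξ (e s))) ∧
    (∀ ξ : S → ℝ, IsConserved φ ξ → IsConserved φ' (fun s' => ξ (e.symm s')))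

/-- Weak equivalence of interactions via a given map `ι : S → S'` : there is `ι' : S' → S`
such that the pullbacks along `ι` and `ι'` induce mutually inverse isomorphisms of the
spaces of conserved quantities modulo constants. -/
def WeakEquivVia {S : Type*} {S' : Type*} (φ : Set ((S × S) × (S × S)))
    (φ' : Set ((S' × S') × (S' × S'))) (ι : S → S') : Prop :=
  ∃ ι' : S' → S,
    (∀ ξ : S' → ℝ, IsConserved φ' ξ → IsConserved φ (fun s => ξ (ι s))) ∧
    (∀ ξ : S → ℝ, IsConserved φ ξ → IsConserved φ' (fun s' => ξ (ι' s'))) ∧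
    (∀ ξ : S → ℝ, IsConserved φ ξ → ∃ c : ℝ, ∀ s, ξ (ι' (ι s)) = ξ s + c) ∧
    (∀ ξ : S' → ℝ, IsConserved φ' ξ → ∃ c : ℝ, ∀ s', ξ (ι (ι' s')) = ξ s' + c)

/-- Weak equivalence of interactions. -/
def WeakEquiv {S : Type*} {S' : Type*} (φ : Set ((S × S) × (S × S)))
    (φ' : Set ((S' × S') × (S' × S'))) : Prop :=
  ∃ ι : S → S', WeakEquivVia φ φ' ι

/-- Separability: distinct local states are distinguished by some conserved quantity. -/
def SeparableInteraction {S : Type*} (φ : Set ((S × S) × (S × S))) : Prop :=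
  ∀ s s' : S, s ≠ s' → ∃ ξ : S → ℝ, IsConserved φ ξ ∧ ξ s ≠ ξ s'

/-- Exchangeability: `(s1, s2)` and `(s2, s1)` always lie in the same connected component. -/
def ExchangeableInteraction {S : Type*} (φ : Set ((S × S) × (S × S))) : Prop :=
  ∀ s1 s2 : S, graphConn φ (s1, s2) (s2, s1)

/-- The completion of an interaction: connect all pairs of vertices on which every
conserved quantity takes equal values. -/
def interactionCompletion {S : Type*} (φ : Set ((S × S) × (S × S))) :
    Set ((S × S) × (S × S)) :=
  {q | ∀ ξ : S → ℝ, IsConserved φ ξ → pairSum ξ q.1 = pairSum ξ q.2}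

/-- The edges of the configuration space with transition structure of `(S, φ)` on `(X, E)`. -/
def configEdge {S X : Type*} (φ : Set ((S × S) × (S × S))) (E : Set (X × X)) :
    Set ((X → S) × (X → S)) :=
  {q | ∃ e ∈ E, ((q.1 e.1, q.1 e.2), (q.2 e.1, q.2 e.2)) ∈ φ ∧
        ∀ z, z ≠ e.1 → z ≠ e.2 → q.1 z = q.2 z}

/-- Same connected component in the configuration space with transition structure. -/
def configConn {S X : Type*} (φ : Set ((S × S) × (S × S))) (E : Set (X × X)) :
    (X → S) → (X → S) → Prop :=
  graphConn (configEdge φ E)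

/-- The interaction `(S, φ)` is irreducibly quantified. -/
def IrreduciblyQuantified {S : Type*} (φ : Set ((S × S) × (S × S))) : Prop :=
  ∀ (X : Type) [Fintype X] (E : Set (X × X)), IsSymmGraph E →
    (∀ x y : X, graphConn E x y) →
    ∀ η η' : X → S,
      (∀ ξ : S → ℝ, IsConserved φ ξ → ∑ x, ξ (η x) = ∑ x, ξ (η' x)) →
      configConn φ E η η'

/-- The relation identifying the two base points in `S1 ⊕ S2`. -/
def wedgeRel {S1 : Type*} {S2 : Type*} (p1 : S1) (p2 : S2) :
    (S1 ⊕ S2) → (S1 ⊕ S2) → Prop :=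
  fun a b => (a = Sum.inl p1 ∧ b = Sum.inr p2) ∨ (a = Sum.inr p2 ∧ b = Sum.inl p1)

/-- The wedge sum `S1 ∨ S2` along base points `p1` and `p2`. -/
def WedgeSum {S1 : Type*} {S2 : Type*} (p1 : S1) (p2 : S2) := Quot (wedgeRel p1 p2)

/-- Inclusion of `S1` into the wedge sum. -/
def wedgeInl {S1 : Type*} {S2 : Type*} (p1 : S1) (p2 : S2) (s : S1) : WedgeSum p1 p2 :=
  Quot.mk _ (Sum.inl s)

/-- Inclusion of `S2` into the wedge sum. -/
def wedgeInr {S1 : Type*} {S2 : Type*} (p1 : S1) (p2 : S2) (s : S2) : WedgeSum p1 p2 :=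
  Quot.mk _ (Sum.inr s)

/-- The wedge sum `φ1 ∨ φ2` of two interactions: all edges of `φ1`, all edges of `φ2`,
and the transposition edges `(s, s') ↔ (s', s)` for `s ∈ S1`, `s' ∈ S2`. -/
def wedgeInteraction {S1 : Type*} {S2 : Type*} (φ1 : Set ((S1 × S1) × (S1 × S1)))
    (φ2 : Set ((S2 × S2) × (S2 × S2))) (p1 : S1) (p2 : S2) :
    Set ((WedgeSum p1 p2 × WedgeSum p1 p2) × (WedgeSum p1 p2 × WedgeSum p1 p2)) :=
  {q | (∃ r ∈ φ1, q = ((wedgeInl p1 p2 r.1.1, wedgeInl p1 p2 r.1.2),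
          (wedgeInl p1 p2 r.2.1, wedgeInl p1 p2 r.2.2))) ∨
       (∃ r ∈ φ2, q = ((wedgeInr p1 p2 r.1.1, wedgeInr p1 p2 r.1.2),
          (wedgeInr p1 p2 r.2.1, wedgeInr p1 p2 r.2.2))) ∨
       (∃ (s : S1) (s' : S2), q = ((wedgeInl p1 p2 s, wedgeInr p1 p2 s'),
          (wedgeInr p1 p2 s', wedgeInl p1 p2 s))) ∨
       (∃ (s : S1) (s' : S2), q = ((wedgeInr p1 p2 s', wedgeInl p1 p2 s),
          (wedgeInl p1 p2 s, wedgeInr p1 p2 s')))}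

/-- The box product `φ1 □ φ2` of two interactions, on `S1 × S2`. -/
def boxProd {S1 : Type*} {S2 : Type*} (φ1 : Set ((S1 × S1) × (S1 × S1)))
    (φ2 : Set ((S2 × S2) × (S2 × S2))) :
    Set (((S1 × S2) × (S1 × S2)) × ((S1 × S2) × (S1 × S2))) :=
  {q | (q.1.1.1 = q.2.1.1 ∧ q.1.2.1 = q.2.2.1 ∧
          ((q.1.1.2, q.1.2.2), (q.2.1.2, q.2.2.2)) ∈ φ2) ∨
       (q.1.1.2 = q.2.1.2 ∧ q.1.2.2 = q.2.2.2 ∧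
          ((q.1.1.1, q.1.2.1), (q.2.1.1, q.2.2.1)) ∈ φ1)}

/-- The `κ`-exclusion interaction on `{0, …, κ}`: edges `(j, k) ↔ (j-1, k+1)` for
`0 < j ≤ κ`, `0 ≤ k < κ`.  `exclK 1` is the exclusion interaction `φ_EX`. -/
def exclK (κ : ℕ) : Set ((Fin (κ + 1) × Fin (κ + 1)) × (Fin (κ + 1) × Fin (κ + 1))) :=
  {q | ∃ j k : Fin (κ + 1), 0 < (j : ℕ) ∧ (k : ℕ) < κ ∧
        (q = ((j, k), (j - 1, k + 1)) ∨ q = ((j - 1, k + 1), (j, k)))}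

/-- The multi-species exclusion interaction `φ_ms^κ` on `{0, …, κ}`. -/
def msExcl (κ : ℕ) : Set ((Fin (κ + 1) × Fin (κ + 1)) × (Fin (κ + 1) × Fin (κ + 1))) :=
  {q | ∃ j k : Fin (κ + 1), j ≠ k ∧ q = ((j, k), (k, j))}

/-- The lattice gas with energy interaction `φ_{κ-LGE}` on `{0, …, κ}`:
edges `(j, k) ↔ (j-1, k+1)` for `j ≥ 2`, `k < κ`, together with
edges `(j, k) ↔ (k, j)` for `j ∈ {0, 1}`, `k ∈ S`, `j ≠ k`. -/
def lge (κ : ℕ) : Set ((Fin (κ + 1) × Fin (κ + 1)) × (Fin (κ + 1) × Fin (κ + 1))) :=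
  {q | (∃ j k : Fin (κ + 1), 2 ≤ (j : ℕ) ∧ (k : ℕ) < κ ∧
          (q = ((j, k), (j - 1, k + 1)) ∨ q = ((j - 1, k + 1), (j, k)))) ∨
       (∃ j k : Fin (κ + 1), (j : ℕ) ≤ 1 ∧ j ≠ k ∧
          (q = ((j, k), (k, j)) ∨ q = ((k, j), (j, k))))}

/-- The Glauber interaction on `{0, 1}`: all four vertices of the graph are connected
into a single component. -/
def glauber : Set ((Fin 2 × Fin 2) × (Fin 2 × Fin 2)) := Set.univ

/-- The standard conserved quantities `ξ^i` on `{0, …, κ}`: `ξ^i (j) = δ_{ij}`. -/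
noncomputable def stdXi (κ : ℕ) (i : Fin (κ + 1)) : Fin (κ + 1) → ℝ := fun t => if t = i then 1 else 0

/-- The identification `{0,1,2,3} ≅ {0,1} × {0,1}`, `0 ↦ (0,0)`, `1 ↦ (1,0)`,
`2 ↦ (0,1)`, `3 ↦ (1,1)`. -/
def identF : Fin 4 → Fin 2 × Fin 2 := ![(0, 0), (1, 0), (0, 1), (1, 1)]

/-- The two-lane exclusion interaction `φ_EX □ φ_EX` on `{0,1,2,3}` under the
identification `identF`. -/
def twoLane : Set ((Fin 4 × Fin 4) × (Fin 4 × Fin 4)) :=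
  {q | ((identF q.1.1, identF q.1.2), (identF q.2.1, identF q.2.2)) ∈ boxProd (exclK 1) (exclK 1)}

/-- The `N`-lane `κ`-exclusion interaction, i.e. the `N`-fold box product of the
`κ`-exclusion interaction, on `{0, …, κ}^N`. -/
def nLane (κ N : ℕ) :
    Set (((Fin N → Fin (κ + 1)) × (Fin N → Fin (κ + 1))) ×
         ((Fin N → Fin (κ + 1)) × (Fin N → Fin (κ + 1)))) :=
  {q | ∃ i : Fin N, (∀ j : Fin N, j ≠ i → q.1.1 j = q.2.1 j ∧ q.1.2 j = q.2.2 j) ∧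
        ((q.1.1 i, q.1.2 i), (q.2.1 i, q.2.2 i)) ∈ exclK κ}

/-- The "new interaction" of the paper: the lattice gas with energy `φ_{3-LGE}` together
with the two edges `(1,1) ↔ (0,3)`. -/
def newInt : Set ((Fin 4 × Fin 4) × (Fin 4 × Fin 4)) :=
  lge 3 ∪ {(((1 : Fin 4), (1 : Fin 4)), ((0 : Fin 4), (3 : Fin 4))),
           (((0 : Fin 4), (3 : Fin 4)), ((1 : Fin 4), (1 : Fin 4)))}

/-- The modified basis `tilde-ξ^i` of Lemma "prop: less". -/
noncomputable def tiltedBasis {S : Type*} {c : ℕ} (xi : Fin c → S → ℝ) (k : Fin c) (s s' : S × S) :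
    Fin c → S → ℝ :=
  fun i t => xi i t -
    ((pairSum (xi i) s' - pairSum (xi i) s) / (pairSum (xi k) s' - pairSum (xi k) s)) * xi k t



section WedgeAux

variable {S W X Y : Type*}

theorem aux_symm {Φ : Set ((W × W) × (W × W))} (hΦ : IsInteraction Φ) {E : Set (X × X)}
    {η η' : X → W} (h : configConn Φ E η η') : configConn Φ E η' η := by
  have hs : Std.Symm (fun a b => (a, b) ∈ configEdge Φ E) := by
    constructor
    rintro a b ⟨e, he, hm, hz⟩
    exact ⟨e, he, hΦ _ hm, fun z h1 h2 => (hz z h1 h2).symm⟩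
  have hs' := hs
  induction h with
  | refl => exact ReflTransGen.refl
  | tail _ hbc ih => exact ReflTransGen.head (hs.symm _ _ hbc) ih

/-- Lifting paths from `Y` to `X`. -/
theorem aux_lift {φ : Set ((S × S) × (S × S))} {Φ : Set ((W × W) × (W × W))}
    (f : S → W) (hf : ∀ r ∈ φ, ((f r.1.1, f r.1.2), (f r.2.1, f r.2.2)) ∈ Φ)
    (i : Y → X) (hi : Function.Injective i) (EY : Set (Y × Y)) (E : Set (X × X))
    (H : ∀ a b, (a, b) ∈ EY → ∀ η η' : X → W,
      ((η (i a), η (i b)), (η' (i a), η' (i b))) ∈ Φ →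
      (∀ z, z ≠ i a → z ≠ i b → η z = η' z) → configConn Φ E η η')
    (η₀ : X → W) {ζ ζ' : Y → S} (h : configConn φ EY ζ ζ') :
    configConn Φ E (Function.extend i (f ∘ ζ) η₀) (Function.extend i (f ∘ ζ') η₀) := by
  induction h with
  | refl => exact ReflTransGen.refl
  | tail _ hbc ih =>
    refine ReflTransGen.trans ih ?_
    obtain ⟨⟨a, b⟩, he, hm, hz⟩ := hbc
    refine H a b he _ _ ?_ ?_
    · simp only [hi.extend_apply]
      exact hf _ hm
    · intro z h1 h2
      by_cases hzr : ∃ y, i y = z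
      · obtain ⟨y, rfl⟩ := hzr
        simp only [hi.extend_apply, Function.comp]
        exact congrArg f (hz y (fun h => h1 (by rw [h])) (fun h => h2 (by rw [h])))
      · rw [Function.extend_apply' _ _ _ hzr, Function.extend_apply' _ _ _ hzr]

/-- exchange within an irreducibly quantified interaction at adjacent sites -/
theorem aux_exch [DecidableEq X] {φ : Set ((S × S) × (S × S))} {Φ : Set ((W × W) × (W × W))}
    (hq : IrreduciblyQuantified φ)
    (f : S → W) (hf : ∀ r ∈ φ, ((f r.1.1, f r.1.2), (f r.2.1, f r.2.2)) ∈ Φ)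
    (E : Set (X × X)) (hE : IsSymmGraph E) (u v : X) (huv : u ≠ v) (he : (u, v) ∈ E)
    (η : X → W) (a b : S) (ha : η u = f a) (hb : η v = f b) :
    configConn Φ E η (η ∘ Equiv.swap u v) := by
  have hc := hq Bool {p | p.1 ≠ p.2} (fun p hp => Ne.symm hp)
    (by
      intro x y
      by_cases h : x = y
      · subst h; exact ReflTransGen.refl
      · exact ReflTransGen.single h)
    (fun t => if t then a else b) (fun t => if t then b else a)
    (by intro ξ _; simp [add_comm])
  have hi : Function.Injective (fun t : Bool => if t then u else v) := by
    intro s t; cases s <;> cases t <;> simp [huv, huv.symm]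
  have := aux_lift (Φ := Φ) f hf (fun t : Bool => if t then u else v) hi _ E (by
    intro s t hst η η' hm hz
    refine ReflTransGen.single ⟨(if s then u else v, if t then u else v), ?_, hm, hz⟩
    cases s <;> cases t <;> simp_all
    exact hE _ he) η hc
  convert this using 1
  · funext x
    by_cases hx : ∃ t : Bool, (if t then u else v) = x
    · obtain ⟨t, rfl⟩ := hx
      refine Eq.trans ?_ (hi.extend_apply _ _ t).symm
      cases t <;> simp [ha, hb]
    · rw [Function.extend_apply' _ _ _ hx]
  · funext x
    by_cases hx : ∃ t : Bool, (if t then u else v) = x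
    · obtain ⟨t, rfl⟩ := hx
      refine Eq.trans ?_ (hi.extend_apply _ _ t).symm
      cases t <;> simp [ha, hb]
    · rw [Function.extend_apply' _ _ _ hx]
      have h1 : x ≠ u := fun h => hx ⟨true, by simp [h]⟩
      have h2 : x ≠ v := fun h => hx ⟨false, by simp [h]⟩
      simp [Equiv.swap_apply_of_ne_of_ne h1 h2]

theorem aux_swap [DecidableEq X] {Φ : Set ((W × W) × (W × W))} {E : Set (X × X)}
    (hadj : ∀ u v, u ≠ v → (u, v) ∈ E → ∀ η : X → W, configConn Φ E η (η ∘ Equiv.swap u v))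
    {x y : X} (h : graphConn E x y) (η : X → W) :
    configConn Φ E η (η ∘ Equiv.swap x y) := by
  induction h generalizing η with
  | refl => simp only [Equiv.swap_self, Equiv.coe_refl, Function.comp_id]; exact ReflTransGen.refl
  | @tail y z _ hbc ih =>
    by_cases hyz : y = z
    · subst hyz; exact ih η
    by_cases hxz : x = z
    · subst hxz; simp only [Equiv.swap_self, Equiv.coe_refl, Function.comp_id]; exact ReflTransGen.refl
    by_cases hxy : x = y
    · subst hxy; exact hadj _ _ hyz hbc η
    have e : η ∘ Equiv.swap x z
        = ((η ∘ Equiv.swap x y) ∘ Equiv.swap y z) ∘ Equiv.swap x y := by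
      funext w
      simp only [Function.comp]
      congr 1
      simp only [Equiv.swap_apply_def]
      grind
    rw [e]
    exact (ih η).trans ((hadj _ _ hyz hbc _).trans (ih _))

theorem aux_perm [DecidableEq X] [Finite X] {Φ : Set ((W × W) × (W × W))} {E : Set (X × X)}
    (hsw : ∀ u v, ∀ η : X → W, configConn Φ E η (η ∘ Equiv.swap u v))
    (σ : Equiv.Perm X) : ∀ η : X → W, configConn Φ E η (η ∘ σ) := by
  induction σ using Equiv.Perm.swap_induction_on with
  | one => intro η; exact ReflTransGen.refl
  | swap_mul f x y hxy ih =>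
    intro η
    exact (hsw x y η).trans (ih _)

theorem aux_nbr {E : Set (X × X)} {x y : X} (h : graphConn E x y) (hxy : x ≠ y) :
    ∃ v, v ≠ x ∧ (x, v) ∈ E := by
  induction h with
  | refl => exact absurd rfl hxy
  | @tail b c _ hbc ih =>
    by_cases hb : x = b
    · subst hb; exact ⟨c, hxy.symm, hbc⟩
    · exact ih hb

/-- moves at arbitrary pairs of distinct sites -/
theorem aux_move [DecidableEq X] {Φ : Set ((W × W) × (W × W))} {E : Set (X × X)}
    (hE : ∀ x y : X, graphConn E x y)
    (hsw : ∀ u v, ∀ η : X → W, configConn Φ E η (η ∘ Equiv.swap u v))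
    (x y : X) (hxy : x ≠ y) (η η' : X → W) (hm : ((η x, η y), (η' x, η' y)) ∈ Φ)
    (hz : ∀ z, z ≠ x → z ≠ y → η z = η' z) : configConn Φ E η η' := by
  obtain ⟨v, hvx, hv⟩ := aux_nbr (hE x y) hxy
  have h1 := hsw y v η
  have h3 := hsw y v (η' ∘ Equiv.swap y v)
  have e : (η' ∘ Equiv.swap y v) ∘ Equiv.swap y v = η' := by
    funext w; simp
  rw [e] at h3
  refine h1.trans (ReflTransGen.trans (ReflTransGen.single ?_) h3)
  refine ⟨(x, v), hv, ?_, ?_⟩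
  · simpa [Equiv.swap_apply_of_ne_of_ne hxy hvx.symm] using hm
  · intro z hzx hzv
    simp only [Function.comp]
    apply hz
    · intro h
      have : z = Equiv.swap y v x := by rw [← h]; simp
      rw [Equiv.swap_apply_of_ne_of_ne hxy hvx.symm] at this
      exact hzx this
    · intro h
      have : z = Equiv.swap y v y := by
        have h' := congrArg (Equiv.swap y v) h
        rwa [Equiv.swap_apply_self] at h'
      rw [Equiv.swap_apply_left] at this
      exact hzv this

end WedgeAux

theorem aux_step {S W : Type*} {X : Type} [Fintype X] [DecidableEq X]
    {φ : Set ((S × S) × (S × S))} {Φ : Set ((W × W) × (W × W))}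
    (hq : IrreduciblyQuantified φ)
    (f : S → W) (g : W → S) (hf : ∀ r ∈ φ, ((f r.1.1, f r.1.2), (f r.2.1, f r.2.2)) ∈ Φ)
    {E : Set (X × X)}
    (hE : ∀ x y : X, graphConn E x y)
    (hsw : ∀ u v, ∀ η : X → W, configConn Φ E η (η ∘ Equiv.swap u v))
    (P : X → Prop) (η η' : X → W)
    (hoff : ∀ x, ¬ P x → η x = η' x)
    (hon : ∀ x, P x → f (g (η x)) = η x) (hon' : ∀ x, P x → f (g (η' x)) = η' x)
    (hsum : ∀ ξ : S → ℝ, IsConserved φ ξ → ∑ x, ξ (g (η x)) = ∑ x, ξ (g (η' x))) :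
    configConn Φ E η η' := by
  classical
  have hc := hq {x // P x} {p | p.1 ≠ p.2} (fun p hp => Ne.symm hp)
    (by
      intro x y
      by_cases h : x = y
      · subst h; exact ReflTransGen.refl
      · exact ReflTransGen.single h)
    (fun t => g (η t.1)) (fun t => g (η' t.1))
    (by
      intro ξ hξ
      have h := hsum ξ hξ
      rw [← Fintype.sum_subtype_add_sum_subtype P (fun x => ξ (g (η x))),
        ← Fintype.sum_subtype_add_sum_subtype P (fun x => ξ (g (η' x)))] at h
      have h2 : ∑ x : {x // ¬ P x}, ξ (g (η x.1)) = ∑ x : {x // ¬ P x}, ξ (g (η' x.1)) :=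
        Finset.sum_congr rfl (fun x _ => by rw [hoff x.1 x.2])
      linarith)
  have := aux_lift (Φ := Φ) f hf (fun t : {x // P x} => t.1) Subtype.val_injective _ E (by
    intro s t hst η η' hm hz
    exact aux_move hE hsw s.1 t.1 (fun h => hst (Subtype.ext h)) η η' hm hz) η hc
  convert this using 1
  · funext x
    by_cases hx : P x
    · refine Eq.trans ?_ (Subtype.val_injective.extend_apply _ _ ⟨x, hx⟩).symm
      exact (hon x hx).symm
    · rw [Function.extend_apply']
      rintro ⟨y, rfl⟩
      exact hx y.2
  · funext x
    by_cases hx : P x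
    · refine Eq.trans ?_ (Subtype.val_injective.extend_apply _ _ ⟨x, hx⟩).symm
      exact (hon' x hx).symm
    · rw [Function.extend_apply', hoff x hx]
      rintro ⟨y, rfl⟩
      exact hx y.2

section Proj

variable {S1 S2 : Type*} (p1 : S1) (p2 : S2)

def wpr1 : WedgeSum p1 p2 → S1 :=
  Quot.lift (Sum.elim id (fun _ => p1)) (by
    rintro a b (⟨rfl, rfl⟩ | ⟨rfl, rfl⟩) <;> rfl)

def wpr2 : WedgeSum p1 p2 → S2 :=
  Quot.lift (Sum.elim (fun _ => p2) id) (by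
    rintro a b (⟨rfl, rfl⟩ | ⟨rfl, rfl⟩) <;> rfl)

theorem wedge_base : wedgeInl p1 p2 p1 = wedgeInr p1 p2 p2 :=
  Quot.sound (Or.inl ⟨rfl, rfl⟩)

theorem wedge_cases (w : WedgeSum p1 p2) :
    (∃ a, w = wedgeInl p1 p2 a) ∨ (∃ b, w = wedgeInr p1 p2 b) := by
  induction w using Quot.ind with
  | mk s =>
    cases s with
    | inl a => exact Or.inl ⟨a, rfl⟩
    | inr b => exact Or.inr ⟨b, rfl⟩

@[simp] theorem wpr1_inl (a : S1) : wpr1 p1 p2 (wedgeInl p1 p2 a) = a := rfl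
@[simp] theorem wpr1_inr (b : S2) : wpr1 p1 p2 (wedgeInr p1 p2 b) = p1 := rfl
@[simp] theorem wpr2_inl (a : S1) : wpr2 p1 p2 (wedgeInl p1 p2 a) = p2 := rfl
@[simp] theorem wpr2_inr (b : S2) : wpr2 p1 p2 (wedgeInr p1 p2 b) = b := rfl

end Proj

theorem aux_core {S1 S2 : Type*} (φ1 : Set ((S1 × S1) × (S1 × S1)))
    (φ2 : Set ((S2 × S2) × (S2 × S2)))
    (hq1 : IrreduciblyQuantified φ1) (hq2 : IrreduciblyQuantified φ2)
    (p1 : S1) (p2 : S2) {X : Type} [Fintype X] [DecidableEq X] {E : Set (X × X)}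
    (hE : ∀ x y : X, graphConn E x y)
    (hsw : ∀ u v, ∀ η : X → WedgeSum p1 p2,
      configConn (wedgeInteraction φ1 φ2 p1 p2) E η (η ∘ Equiv.swap u v))
    (η η' : X → WedgeSum p1 p2)
    (hs1 : ∀ ξ : S1 → ℝ, IsConserved φ1 ξ →
      ∑ x, ξ (wpr1 p1 p2 (η x)) = ∑ x, ξ (wpr1 p1 p2 (η' x)))
    (hs2 : ∀ ξ : S2 → ℝ, IsConserved φ2 ξ →
      ∑ x, ξ (wpr2 p1 p2 (η x)) = ∑ x, ξ (wpr2 p1 p2 (η' x)))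
    (hB : ∀ x, (∃ a, η' x = wedgeInl p1 p2 a) → ∃ a, η x = wedgeInl p1 p2 a) :
    configConn (wedgeInteraction φ1 φ2 p1 p2) E η η' := by
  classical
  let mid : X → WedgeSum p1 p2 := fun x =>
    if (∃ a, η x = wedgeInl p1 p2 a) then wedgeInl p1 p2 (wpr1 p1 p2 (η' x)) else η x
  have hpos : ∀ x, (∃ a, η x = wedgeInl p1 p2 a) →
      mid x = wedgeInl p1 p2 (wpr1 p1 p2 (η' x)) := fun x h => if_pos h
  have hneg : ∀ x, ¬ (∃ a, η x = wedgeInl p1 p2 a) → mid x = η x := fun x h => if_neg h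
  have m1 : ∀ x, wpr1 p1 p2 (mid x) = wpr1 p1 p2 (η' x) := by
    intro x
    by_cases h : ∃ a, η x = wedgeInl p1 p2 a
    · rw [hpos x h, wpr1_inl]
    · rw [hneg x h]
      obtain ⟨b, hb⟩ := (wedge_cases p1 p2 (η x)).resolve_left h
      obtain ⟨b', hb'⟩ := (wedge_cases p1 p2 (η' x)).resolve_left (fun h' => h (hB x h'))
      rw [hb, hb', wpr1_inr, wpr1_inr]
  have m2 : ∀ x, wpr2 p1 p2 (mid x) = wpr2 p1 p2 (η x) := by
    intro x
    by_cases h : ∃ a, η x = wedgeInl p1 p2 a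
    · rw [hpos x h, wpr2_inl]
      obtain ⟨a, ha⟩ := h
      rw [ha, wpr2_inl]
    · rw [hneg x h]
  have st1 : configConn (wedgeInteraction φ1 φ2 p1 p2) E η mid := by
    refine aux_step hq1 (wedgeInl p1 p2) (wpr1 p1 p2) (fun r hr => Or.inl ⟨r, hr, rfl⟩) hE hsw
      (fun x => ∃ a, η x = wedgeInl p1 p2 a) η mid ?_ ?_ ?_ ?_
    · intro x hx; exact (hneg x hx).symm
    · rintro x ⟨a, ha⟩; rw [ha, wpr1_inl]
    · intro x hx; rw [hpos x hx, wpr1_inl]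
    · intro ξ hξ; simp only [m1]; exact hs1 ξ hξ
  have st2 : configConn (wedgeInteraction φ1 φ2 p1 p2) E mid η' := by
    refine aux_step hq2 (wedgeInr p1 p2) (wpr2 p1 p2) (fun r hr => Or.inr (Or.inl ⟨r, hr, rfl⟩))
      hE hsw (fun x => ∃ b, η' x = wedgeInr p1 p2 b) mid η' ?_ ?_ ?_ ?_
    · intro x hx
      have h := (wedge_cases p1 p2 (η' x)).resolve_right hx
      rw [hpos x (hB x h)]
      obtain ⟨a, ha⟩ := h
      rw [ha, wpr1_inl]
    · rintro x ⟨b, hb⟩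
      by_cases h : ∃ a, η x = wedgeInl p1 p2 a
      · rw [hpos x h, wpr2_inl, hb, wpr1_inr, wedge_base]
      · rw [hneg x h]
        obtain ⟨b, hb⟩ := (wedge_cases p1 p2 (η x)).resolve_left h
        rw [hb, wpr2_inr]
    · rintro x ⟨b, hb⟩; rw [hb, wpr2_inr]
    · intro ξ hξ; simp only [m2]; exact hs2 ξ hξ
  exact st1.trans st2

theorem aux_match {X : Type*} [Fintype X] [DecidableEq X] (B B' : Finset X)
    (h : B.card ≤ B'.card) : ∃ σ : Equiv.Perm X, ∀ x, σ x ∈ B → x ∈ B' := by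
  obtain ⟨T, hT, hc⟩ := Finset.exists_subset_card_eq h
  have e : {x // x ∈ B} ≃ {x // x ∈ T} := Finset.equivOfCardEq hc.symm
  refine ⟨(Equiv.extendSubtype e).symm, fun x hx => hT ?_⟩
  have := Equiv.extendSubtype_mem e _ hx
  simpa using this

theorem stmt16 {S1 S2 : Type*} (φ1 : Set ((S1 × S1) × (S1 × S1)))
    (φ2 : Set ((S2 × S2) × (S2 × S2))) (h1 : IsInteraction φ1) (h2 : IsInteraction φ2)
    (hq1 : IrreduciblyQuantified φ1) (hq2 : IrreduciblyQuantified φ2)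
    (p1 : S1) (p2 : S2) :
    IrreduciblyQuantified (wedgeInteraction φ1 φ2 p1 p2) := by
  classical
  intro X _ E hsym hE η η' hη
  have hΦ : IsInteraction (wedgeInteraction φ1 φ2 p1 p2) := by
    rintro p (⟨r, hr, rfl⟩ | ⟨r, hr, rfl⟩ | ⟨s, s', rfl⟩ | ⟨s, s', rfl⟩)
    · exact Or.inl ⟨_, h1 r hr, rfl⟩
    · exact Or.inr (Or.inl ⟨_, h2 r hr, rfl⟩)
    · exact Or.inr (Or.inr (Or.inr ⟨s, s', rfl⟩))
    · exact Or.inr (Or.inr (Or.inl ⟨s, s', rfl⟩))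
  have hs1 : ∀ ξ : S1 → ℝ, IsConserved φ1 ξ →
      ∑ x, ξ (wpr1 p1 p2 (η x)) = ∑ x, ξ (wpr1 p1 p2 (η' x)) := by
    intro ξ hξ
    refine hη (fun w => ξ (wpr1 p1 p2 w)) ?_
    rintro p (⟨r, hr, rfl⟩ | ⟨r, hr, rfl⟩ | ⟨s, s', rfl⟩ | ⟨s, s', rfl⟩)
    · exact hξ r hr
    · rfl
    · exact add_comm _ _
    · exact add_comm _ _
  have hs2 : ∀ ξ : S2 → ℝ, IsConserved φ2 ξ →
      ∑ x, ξ (wpr2 p1 p2 (η x)) = ∑ x, ξ (wpr2 p1 p2 (η' x)) := by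
    intro ξ hξ
    refine hη (fun w => ξ (wpr2 p1 p2 w)) ?_
    rintro p (⟨r, hr, rfl⟩ | ⟨r, hr, rfl⟩ | ⟨s, s', rfl⟩ | ⟨s, s', rfl⟩)
    · rfl
    · exact hξ r hr
    · exact add_comm _ _
    · exact add_comm _ _
  have hadj : ∀ u v, u ≠ v → (u, v) ∈ E → ∀ η : X → WedgeSum p1 p2,
      configConn (wedgeInteraction φ1 φ2 p1 p2) E η (η ∘ Equiv.swap u v) := by
    intro u v huv he η
    have hz : ∀ z, z ≠ u → z ≠ v → η z = (η ∘ Equiv.swap u v) z := by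
      intro z hzu hzv
      simp [Equiv.swap_apply_of_ne_of_ne hzu hzv]
    rcases wedge_cases p1 p2 (η u) with ⟨a, ha⟩ | ⟨a, ha⟩ <;>
      rcases wedge_cases p1 p2 (η v) with ⟨b, hb⟩ | ⟨b, hb⟩
    · exact aux_exch hq1 (wedgeInl p1 p2) (fun r hr => Or.inl ⟨r, hr, rfl⟩) E hsym u v huv he
        η a b ha hb
    · refine ReflTransGen.single ⟨(u, v), he, Or.inr (Or.inr (Or.inl ⟨a, b, ?_⟩)), hz⟩
      simp [ha, hb]
    · refine ReflTransGen.single ⟨(u, v), he, Or.inr (Or.inr (Or.inr ⟨b, a, ?_⟩)), hz⟩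
      simp [ha, hb]
    · exact aux_exch hq2 (wedgeInr p1 p2) (fun r hr => Or.inr (Or.inl ⟨r, hr, rfl⟩)) E hsym
        u v huv he η a b ha hb
  have hsw : ∀ u v, ∀ η : X → WedgeSum p1 p2,
      configConn (wedgeInteraction φ1 φ2 p1 p2) E η (η ∘ Equiv.swap u v) :=
    fun u v η => aux_swap hadj (hE u v) η
  have key : ∀ η η' : X → WedgeSum p1 p2,
      (∀ ξ : S1 → ℝ, IsConserved φ1 ξ →
        ∑ x, ξ (wpr1 p1 p2 (η x)) = ∑ x, ξ (wpr1 p1 p2 (η' x))) →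
      (∀ ξ : S2 → ℝ, IsConserved φ2 ξ →
        ∑ x, ξ (wpr2 p1 p2 (η x)) = ∑ x, ξ (wpr2 p1 p2 (η' x))) →
      (Finset.univ.filter (fun x => ¬ ∃ a, η x = wedgeInl p1 p2 a)).card ≤
        (Finset.univ.filter (fun x => ¬ ∃ a, η' x = wedgeInl p1 p2 a)).card →
      configConn (wedgeInteraction φ1 φ2 p1 p2) E η η' := by
    intro η η' hs1 hs2 hc
    obtain ⟨σ, hσ⟩ := aux_match _ _ hc
    refine (aux_perm hsw σ η).trans (aux_core φ1 φ2 hq1 hq2 p1 p2 hE hsw _ _ ?_ ?_ ?_)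
    · intro ξ hξ
      rw [← hs1 ξ hξ]
      exact Equiv.sum_comp σ (fun x => ξ (wpr1 p1 p2 (η x)))
    · intro ξ hξ
      rw [← hs2 ξ hξ]
      exact Equiv.sum_comp σ (fun x => ξ (wpr2 p1 p2 (η x)))
    · intro x hx
      by_contra hcon
      have := hσ x (by simpa using hcon)
      simp only [Finset.mem_filter, Finset.mem_univ, true_and] at this
      exact this hx
  rcases le_total (Finset.univ.filter (fun x => ¬ ∃ a, η x = wedgeInl p1 p2 a)).card
      (Finset.univ.filter (fun x => ¬ ∃ a, η' x = wedgeInl p1 p2 a)).card with h | h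
  · exact key η η' hs1 hs2 h
  · exact aux_symm hΦ (key η' η (fun ξ hξ => (hs1 ξ hξ).symm) (fun ξ hξ => (hs2 ξ hξ).symm) h)
end

section
/- Let (S1, phi1) and (S2, phi2) be irreducibly quantified interactions. Then the box product interaction (S1 x S2, phi1 box phi2) is irreducibly quantified. -/
open Relation

universe u

theorem liftFst {S1 S2 X : Type*} (φ1 : Set ((S1 × S1) × (S1 × S1)))
    (φ2 : Set ((S2 × S2) × (S2 × S2))) (E : Set (X × X)) (b : X → S2) (a a' : X → S1)
    (h : configConn φ1 E a a') :
    configConn (boxProd φ1 φ2) E (fun x => (a x, b x)) (fun x => (a' x, b x)) := by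
  refine Relation.ReflTransGen.lift (fun (a : X → S1) (x : X) => (a x, b x)) ?_ _ _ h
  rintro c d ⟨e, he, hφ, hz⟩
  refine ⟨e, he, Or.inr ⟨rfl, rfl, hφ⟩, fun z h1 h2 => ?_⟩
  exact Prod.ext (hz z h1 h2) rfl

theorem liftSnd {S1 S2 X : Type*} (φ1 : Set ((S1 × S1) × (S1 × S1)))
    (φ2 : Set ((S2 × S2) × (S2 × S2))) (E : Set (X × X)) (a : X → S1) (b b' : X → S2)
    (h : configConn φ2 E b b') :
    configConn (boxProd φ1 φ2) E (fun x => (a x, b x)) (fun x => (a x, b' x)) := by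
  refine Relation.ReflTransGen.lift (fun (b : X → S2) (x : X) => (a x, b x)) ?_ _ _ h
  rintro c d ⟨e, he, hφ, hz⟩
  refine ⟨e, he, Or.inl ⟨rfl, rfl, hφ⟩, fun z h1 h2 => ?_⟩
  exact Prod.ext rfl (hz z h1 h2)

/-- the box product of two irreducibly quantified interactions is
irreducibly quantified. -/
theorem stmt17 {S1 S2 : Type*} (φ1 : Set ((S1 × S1) × (S1 × S1)))
    (φ2 : Set ((S2 × S2) × (S2 × S2))) (h1 : IsInteraction φ1) (h2 : IsInteraction φ2)
    (hq1 : IrreduciblyQuantified φ1) (hq2 : IrreduciblyQuantified φ2) :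
    IrreduciblyQuantified (boxProd φ1 φ2) := by
  intro X _ E hE hc η η' h
  have c1 : configConn φ1 E (fun x => (η x).1) (fun x => (η' x).1) := by
    refine hq1 X E hE hc _ _ (fun ξ hξ => h (fun s => ξ s.1) ?_)
    rintro p (⟨e1, e2, _⟩ | ⟨_, _, hp⟩)
    · simp only [e1, e2]
    · exact hξ _ hp
  have c2 : configConn φ2 E (fun x => (η x).2) (fun x => (η' x).2) := by
    refine hq2 X E hE hc _ _ (fun ξ hξ => h (fun s => ξ s.2) ?_)
    rintro p (⟨_, _, hp⟩ | ⟨e1, e2, _⟩)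
    · exact hξ _ hp
    · simp only [e1, e2]
  exact Relation.ReflTransGen.trans
    (liftFst φ1 φ2 E (fun x => (η x).2) _ _ c1)
    (liftSnd φ1 φ2 E (fun x => (η' x).1) _ _ c2)
end

section
/- Let kappa >= 1 and N >= 1 be integers. The following interactions are irreducibly quantified: (1) the kappa-exclusion interaction phi_{kappa-EX} on {0, ..., kappa}; (2) the multi-species exclusion interaction phi_ms^kappa on {0, ..., kappa}; (3) the lattice gas with energy interaction phi_{kappa-LGE} (the wedge sum phi_EX v phi_{(kappa-1)-EX} along 1 in {0,1} and 0 in {0, ..., kappa-1}); (4) the N-lane kappa-exclusion interaction, i.e. the N-fold box product of phi_{kappa-EX} with itself, on {0, ..., kappa}^N. -/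
open Relation

universe u

theorem rtg_lift {α β : Type*} {r : α → α → Prop} {p : β → β → Prop} {a b : α} (f : α → β)
    (h : ∀ a b, r a b → p (f a) (f b)) (hab : Relation.ReflTransGen r a b) :
    Relation.ReflTransGen p (f a) (f b) := by
  induction hab with
  | refl => exact Relation.ReflTransGen.refl
  | tail _ h2 ih => exact ih.tail (h _ _ h2)

theorem exclK_mem {k : ℕ} (a b a' b' : Fin (k+1)) (h1 : (a:ℕ) = a' + 1) (h2 : (b:ℕ) + 1 = b') :
    ((a, b), (a', b')) ∈ exclK k ∧ ((a', b'), (a, b)) ∈ exclK k := by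
  have ha : a - 1 = a' := by
    rw [sub_eq_iff_eq_add]
    apply Fin.ext
    rw [Fin.val_add_one_of_lt', h1]
    have := a.2
    omega
  have hb : b + 1 = b' := by
    apply Fin.ext
    rw [Fin.val_add_one_of_lt', h2]
    have := b'.2
    omega
  have := b'.2
  exact ⟨⟨a, b, by omega, by omega, Or.inl (by rw [ha, hb])⟩,
    ⟨a, b, by omega, by omega, Or.inr (by rw [ha, hb])⟩⟩

theorem exclK_val {k : ℕ} (j l : Fin (k+1)) (hj : 0 < (j:ℕ)) (hl : (l:ℕ) < k) :
    ((j - 1 : Fin (k+1)) : ℕ) + 1 = j ∧ ((l + 1 : Fin (k+1)) : ℕ) = l + 1 := by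
  constructor
  · have : j ≠ 0 := by
      rintro rfl
      simp at hj
    rw [Fin.val_sub_one_of_ne_zero this]
    omega
  · rw [Fin.val_add_one_of_lt']
    omega

theorem transfer_lem {X L : Type*} [Fintype X] [Fintype L] (k : ℕ)
    (R : (X → L → Fin (k+1)) → (X → L → Fin (k+1)) → Prop)
    (hrefl : ∀ η, R η η) (htrans : ∀ a b c, R a b → R b c → R a c)
    (hmove : ∀ η η' x y i, x ≠ y →
      (∀ z j, (z = x ∧ j = i) ∨ (z = y ∧ j = i) ∨ η z j = η' z j) →
      (η x i : ℕ) = η' x i + 1 → (η y i : ℕ) + 1 = η' y i → R η η')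
    (η η' : X → L → Fin (k+1))
    (h : ∀ i, ∑ x, (η x i : ℕ) = ∑ x, (η' x i : ℕ)) : R η η' := by
  classical
  generalize hn : ∑ x, ∑ i, Nat.dist (η x i) (η' x i) = n
  induction n using Nat.strong_induction_on generalizing η with
  | _ n ih =>
  by_cases heq : η = η'
  · rw [heq]; exact hrefl _
  · have : ∃ x i, η x i ≠ η' x i := by
      by_contra hc
      push Not at hc
      exact heq (funext fun x => funext fun i => hc x i)
    obtain ⟨x0, i, hx0⟩ := this
    have hx0' : (η x0 i : ℕ) ≠ η' x0 i := fun h => hx0 (Fin.ext h)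
    have e1 : ∃ x, (η' x i : ℕ) < η x i := by
      by_contra hc
      push Not at hc
      have := Finset.sum_lt_sum (s := Finset.univ) (fun x _ => hc x)
        ⟨x0, Finset.mem_univ _, lt_of_le_of_ne (hc x0) hx0'⟩
      exact absurd (h i) this.ne
    have e2 : ∃ x, (η x i : ℕ) < η' x i := by
      by_contra hc
      push Not at hc
      have := Finset.sum_lt_sum (s := Finset.univ) (fun x _ => hc x)
        ⟨x0, Finset.mem_univ _, lt_of_le_of_ne (hc x0) hx0'.symm⟩
      exact absurd (h i) this.ne'
    obtain ⟨x, hx⟩ := e1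
    obtain ⟨y, hy⟩ := e2
    have hxy : x ≠ y := by
      rintro rfl
      omega
    have hxk := (η x i).2
    have hyk := (η' y i).2
    let ζ : X → L → Fin (k+1) := fun z j =>
      if z = x ∧ j = i then ⟨(η x i : ℕ) - 1, by omega⟩
      else if z = y ∧ j = i then ⟨(η y i : ℕ) + 1, by omega⟩ else η z j
    have zx : (ζ x i : ℕ) = (η x i : ℕ) - 1 := by simp [ζ]
    have zy : (ζ y i : ℕ) = (η y i : ℕ) + 1 := by simp [ζ, hxy.symm]
    have zo : ∀ z j, (z = x ∧ j = i) ∨ (z = y ∧ j = i) ∨ η z j = ζ z j := by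
      intro z j
      by_cases h1 : z = x ∧ j = i
      · exact Or.inl h1
      by_cases h2 : z = y ∧ j = i
      · exact Or.inr (Or.inl h2)
      right; right
      simp only [ζ, if_neg h1, if_neg h2]
    refine htrans _ ζ _ (hmove η ζ x y i hxy zo (by omega) (by omega)) ?_
    refine ih (∑ x, ∑ i, Nat.dist (ζ x i) (η' x i)) ?_ ζ ?_ rfl
    · rw [← hn]
      have key : ∀ z j, Nat.dist (ζ z j) (η' z j) ≤ Nat.dist (η z j) (η' z j) := by
        intro z j
        rcases zo z j with ⟨rfl, rfl⟩ | ⟨rfl, rfl⟩ | h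
        · rw [zx]; unfold Nat.dist; omega
        · rw [zy]; unfold Nat.dist; omega
        · rw [h]
      apply Finset.sum_lt_sum
      · intro z _
        exact Finset.sum_le_sum fun j _ => key z j
      · refine ⟨x, Finset.mem_univ _, Finset.sum_lt_sum (fun j _ => key x j)
          ⟨i, Finset.mem_univ _, ?_⟩⟩
        rw [zx]; unfold Nat.dist; omega
    · intro j
      rw [← h j]
      by_cases hj : j = i
      · subst hj
        rw [← Finset.add_sum_erase _ _ (Finset.mem_univ x),
          ← Finset.add_sum_erase (Finset.univ.erase x) _
            (Finset.mem_erase.2 ⟨hxy.symm, Finset.mem_univ y⟩),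
          ← Finset.add_sum_erase (Finset.univ) (fun x => (η x j : ℕ)) (Finset.mem_univ x),
          ← Finset.add_sum_erase (Finset.univ.erase x) (fun x => (η x j : ℕ))
            (Finset.mem_erase.2 ⟨hxy.symm, Finset.mem_univ y⟩), zx, zy]
        have : ∑ z ∈ (Finset.univ.erase x).erase y, (ζ z j : ℕ)
            = ∑ z ∈ (Finset.univ.erase x).erase y, (η z j : ℕ) := by
          apply Finset.sum_congr rfl
          intro z hz
          simp only [Finset.mem_erase, Finset.mem_univ, and_true] at hz
          rcases zo z j with h | h | h
          · exact absurd h.1 hz.2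
          · exact absurd h.1 hz.1
          · rw [h]
        omega
      · apply Finset.sum_congr rfl
        intro z _
        rcases zo z j with h | h | h
        · exact absurd h.2 hj
        · exact absurd h.2 hj
        · rw [h]

theorem edgeMove {S X : Type*} (φ : Set ((S × S) × (S × S))) (E : Set (X × X))
    {x y : X} (hxy : x ≠ y) (he : (x, y) ∈ E) (η η' : X → S)
    (ho : ∀ z, z ≠ x → z ≠ y → η z = η' z)
    (h : graphConn φ (η x, η y) (η' x, η' y)) : configConn φ E η η' := by
  classical
  let F : S × S → X → S := fun p z => if z = x then p.1 else if z = y then p.2 else η z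
  have h1 : F (η x, η y) = η := by
    funext z
    simp only [F]
    split_ifs with a b
    · rw [a]
    · rw [b]
    · rfl
  have h2 : F (η' x, η' y) = η' := by
    funext z
    simp only [F]
    split_ifs with a b
    · rw [a]
    · rw [b]
    · exact ho z a b
  rw [← h1, ← h2]
  refine rtg_lift F ?_ h
  intro p q hpq
  refine ⟨(x, y), he, ?_, ?_⟩
  · simpa [F, hxy.symm] using hpq
  · intro z hz1 hz2
    simp only at hz1 hz2
    simp [F, hz1, hz2]

theorem swapConn {S X : Type*} [DecidableEq X] (φ : Set ((S × S) × (S × S))) (E : Set (X × X))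
    (hex : ExchangeableInteraction φ) {x y : X} (h : graphConn E x y) (η : X → S) :
    configConn φ E η (η ∘ Equiv.swap x y) := by
  induction h generalizing η with
  | refl => simp only [Equiv.swap_self]; exact Relation.ReflTransGen.refl
  | @tail b c hb hbc ih =>
    have edge : ∀ η : X → S, configConn φ E η (η ∘ Equiv.swap b c) := by
      intro η
      by_cases hbc' : b = c
      · subst hbc'
        simp only [Equiv.swap_self]; exact Relation.ReflTransGen.refl
      · refine edgeMove φ E hbc' hbc _ _ ?_ ?_
        · intro z h1 h2
          simp [Equiv.swap_apply_of_ne_of_ne h1 h2]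
        · simpa using hex (η b) (η c)
    by_cases hxc : x = c
    · subst hxc
      simp only [Equiv.swap_self]; exact Relation.ReflTransGen.refl
    by_cases hxb : x = b
    · subst hxb
      exact edge η
    by_cases hbc' : b = c
    · subst hbc'
      exact ih η
    have e : Equiv.swap x c = Equiv.swap x b * Equiv.swap b c * Equiv.swap x b := by
      ext z
      simp only [Equiv.Perm.mul_apply, Equiv.swap_apply_def]
      grind
    have : η ∘ Equiv.swap x c = ((η ∘ Equiv.swap x b) ∘ Equiv.swap b c) ∘ Equiv.swap x b := by
      rw [e]; rfl
    rw [this]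
    exact (ih η).trans ((edge _).trans (ih _))

theorem pairMove {S X : Type*} (φ : Set ((S × S) × (S × S))) (E : Set (X × X))
    (hex : ExchangeableInteraction φ) {x y : X} (hc : graphConn E x y) (hxy : x ≠ y)
    (η η' : X → S)
    (ho : ∀ z, z ≠ x → z ≠ y → η z = η' z)
    (h : graphConn φ (η x, η y) (η' x, η' y)) : configConn φ E η η' := by
  classical
  induction hc using Relation.ReflTransGen.head_induction_on generalizing η η' with
  | refl => exact absurd rfl hxy
  | @head a b hab hby ih =>
    by_cases hb : b = y
    · subst hb
      exact edgeMove φ E hxy hab η η' ho h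
    have hs : ∀ η : X → S, configConn φ E η (η ∘ Equiv.swap a b) :=
      swapConn φ E hex (Relation.ReflTransGen.single hab)
    have h3 := hs (η' ∘ Equiv.swap a b)
    have e : (η' ∘ Equiv.swap a b) ∘ Equiv.swap a b = η' := by
      funext z; simp
    rw [e] at h3
    refine (hs η).trans (Relation.ReflTransGen.trans ?_ h3)
    apply ih hb
    · intro z h1 h2
      simp only [Function.comp]
      apply ho
      · intro h; apply h1
        rw [← Equiv.swap_apply_left a b, ← h]; simp at *; grind
      · intro h; apply h2
        have : z = Equiv.swap a b y := by rw [← h]; simp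
        rw [this, Equiv.swap_apply_of_ne_of_ne (Ne.symm hxy) (Ne.symm hb)]
    · simpa [Equiv.swap_apply_of_ne_of_ne (Ne.symm hxy) (Ne.symm hb)] using h

theorem permConn {S X : Type*} [Fintype X] (φ : Set ((S × S) × (S × S))) (E : Set (X × X))
    (hex : ExchangeableInteraction φ) (hc : ∀ x y, graphConn E x y) (σ : Equiv.Perm X)
    (η : X → S) : configConn φ E η (η ∘ σ) := by
  classical
  induction σ using Equiv.Perm.swap_induction_on generalizing η with
  | one => exact Relation.ReflTransGen.refl
  | swap_mul f x y hxy ih =>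
    have : η ∘ ⇑(Equiv.swap x y * f) = (η ∘ Equiv.swap x y) ∘ f := rfl
    rw [this]
    exact (swapConn φ E hex (hc x y) η).trans (ih _)

theorem exists_perm {X T : Type*} [Fintype X] [DecidableEq T] (f g : X → T)
    (h : ∀ t, ∑ x, (if f x = t then (1:ℝ) else 0) = ∑ x, (if g x = t then (1:ℝ) else 0)) :
    ∃ σ : Equiv.Perm X, f ∘ σ = g := by
  have e : ∀ t, Nonempty ({x // g x = t} ≃ {x // f x = t}) := by
    intro t
    rw [← Fintype.card_eq]
    have := h t
    simp only [Finset.sum_boole] at this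
    rw [Fintype.card_subtype, Fintype.card_subtype]
    exact_mod_cast this.symm
  refine ⟨Equiv.ofFiberEquiv fun t => (e t).some, ?_⟩
  funext x
  exact Equiv.ofFiberEquiv_map _ x

theorem nLane_exch (κ N : ℕ) : ExchangeableInteraction (nLane κ N) := by
  intro s1 s2
  have := transfer_lem (X := Fin 2) (L := Fin N) κ
    (fun η η' => graphConn (nLane κ N) (η 0, η 1) (η' 0, η' 1))
    (fun _ => Relation.ReflTransGen.refl) (fun a b c h1 h2 => h1.trans h2) ?_
    ![s1, s2] ![s2, s1] ?_
  · simpa using this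
  · intro η η' x y i hxy ho hx hy
    apply Relation.ReflTransGen.single
    refine ⟨i, ?_, ?_⟩
    · intro j hj
      exact ⟨by simpa [hj] using ho 0 j, by simpa [hj] using ho 1 j⟩
    · have := exclK_mem _ _ _ _ hx hy
      have h2 := exclK_mem _ _ _ _ hy.symm hx.symm
      fin_cases x <;> fin_cases y
      · exact absurd rfl hxy
      · exact this.1
      · exact h2.2
      · exact absurd rfl hxy
  · intro i
    simp [Fin.sum_univ_two, add_comm]

theorem nLane_IQ (κ N : ℕ) : IrreduciblyQuantified (nLane κ N) := by
  intro X _ E hE hc η η' hcons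
  refine transfer_lem κ (fun η η' => configConn (nLane κ N) E η η')
    (fun _ => Relation.ReflTransGen.refl) (fun a b c h1 h2 => h1.trans h2) ?_ η η' ?_
  · intro η η' x y i hxy ho hx hy
    refine pairMove _ E (nLane_exch κ N) (hc x y) hxy η η' ?_ ?_
    · intro z h1 h2
      funext j
      simpa [h1, h2] using ho z j
    · apply Relation.ReflTransGen.single
      refine ⟨i, ?_, (exclK_mem _ _ _ _ hx hy).1⟩
      intro j hj
      exact ⟨by simpa [hj] using ho x j, by simpa [hj] using ho y j⟩
  · intro i
    have := hcons (fun s => ((s i : ℕ) : ℝ)) ?_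
    · exact_mod_cast this
    · rintro ⟨⟨a, b⟩, ⟨c, d⟩⟩ ⟨i', h1, h2⟩
      simp only at h1 h2 ⊢
      by_cases hi : i = i'
      · subst hi
        obtain ⟨j, l, hj, hl, h⟩ := h2
        obtain ⟨v1, v2⟩ := exclK_val j l hj hl
        simp only [Prod.mk.injEq] at h
        rcases h with ⟨⟨e1, e2⟩, e3, e4⟩ | ⟨⟨e1, e2⟩, e3, e4⟩ <;>
        · rw [e1, e2, e3, e4]
          norm_cast
          omega
      · rw [(h1 i hi).1, (h1 i hi).2]

theorem exclK_IQ (κ : ℕ) : IrreduciblyQuantified (exclK κ) := by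
  intro X _ E hE hc η η' hcons
  have := nLane_IQ κ 1 X E hE hc (fun x _ => η x) (fun x _ => η' x) ?_
  · refine rtg_lift (fun (ζ : X → Fin 1 → Fin (κ+1)) x => ζ x 0) ?_ this
    rintro a b ⟨e, he, ⟨i, -, h2⟩, h3⟩
    have : i = 0 := Subsingleton.elim _ _
    subst this
    exact ⟨e, he, h2, fun z hz1 hz2 => congrFun (h3 z hz1 hz2) 0⟩
  · intro ξ hξ
    apply hcons (fun s => ξ fun _ => s)
    rintro ⟨⟨a, b⟩, ⟨c, d⟩⟩ h
    exact hξ ((fun _ => a, fun _ => b), (fun _ => c, fun _ => d))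
      ⟨0, fun j hj => absurd (Subsingleton.elim _ _) hj, h⟩

theorem exclK_exch (κ : ℕ) : ExchangeableInteraction (exclK κ) := by
  intro s1 s2
  have := nLane_exch κ 1 (fun _ => s1) (fun _ => s2)
  refine rtg_lift
    (fun (p : (Fin 1 → Fin (κ+1)) × (Fin 1 → Fin (κ+1))) => (p.1 0, p.2 0)) ?_ this
  rintro a b ⟨i, -, h2⟩
  have : i = 0 := Subsingleton.elim _ _
  subst this
  exact h2

theorem msExcl_exch (κ : ℕ) : ExchangeableInteraction (msExcl κ) := by
  intro s1 s2
  by_cases h : s1 = s2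
  · subst h; exact Relation.ReflTransGen.refl
  · exact Relation.ReflTransGen.single ⟨s1, s2, h, rfl⟩

theorem msExcl_IQ (κ : ℕ) : IrreduciblyQuantified (msExcl κ) := by
  intro X _ E hE hc η η' hcons
  obtain ⟨σ, rfl⟩ := exists_perm η η' (fun t => hcons (fun s => if s = t then 1 else 0) (by
    rintro ⟨⟨a, b⟩, ⟨c, d⟩⟩ ⟨j, l, _, h⟩
    simp only [Prod.mk.injEq] at h
    obtain ⟨⟨rfl, rfl⟩, rfl, rfl⟩ := h
    simp only
    ring))
  exact permConn _ E (msExcl_exch κ) hc σ η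

abbrev WS (k : ℕ) := WedgeSum (1 : Fin 2) (0 : Fin (k+1))

theorem ws_base (k : ℕ) : wedgeInl (1 : Fin 2) (0 : Fin (k+1)) 1 = wedgeInr 1 0 0 :=
  Quot.sound (Or.inl ⟨rfl, rfl⟩)

theorem ws_cases {k : ℕ} (s : WS k) :
    s = wedgeInl 1 0 0 ∨ ∃ j, s = wedgeInr 1 0 j := by
  induction s using Quot.ind with
  | _ a =>
    rcases a with a | j
    · fin_cases a
      · exact Or.inl rfl
      · exact Or.inr ⟨0, ws_base k⟩
    · exact Or.inr ⟨j, rfl⟩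

/-- particle number -/
def wsNum (k : ℕ) : WS k → Bool :=
  Quot.lift (Sum.elim (fun s => decide (s = 1)) (fun _ => true)) (by
    rintro a b (⟨rfl, rfl⟩ | ⟨rfl, rfl⟩) <;> simp)

/-- energy -/
def wsEn (k : ℕ) : WS k → ℕ :=
  Quot.lift (Sum.elim (fun _ => 0) (fun j : Fin (k+1) => (j : ℕ))) (by
    rintro a b (⟨rfl, rfl⟩ | ⟨rfl, rfl⟩) <;> simp)

theorem exclK_cons (k : ℕ) : IsConserved (exclK k) (fun s => ((s : ℕ) : ℝ)) := by
  rintro ⟨⟨a, b⟩, ⟨c, d⟩⟩ ⟨j, l, hj, hl, h⟩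
  obtain ⟨v1, v2⟩ := exclK_val j l hj hl
  simp only [Prod.mk.injEq] at h
  rcases h with ⟨⟨rfl, rfl⟩, rfl, rfl⟩ | ⟨⟨rfl, rfl⟩, rfl, rfl⟩ <;>
  · simp only
    norm_cast
    omega

theorem wedge_cons {k : ℕ} (ξ : WS k → ℝ)
    (h1 : IsConserved (exclK 1) (fun s => ξ (wedgeInl 1 0 s)))
    (h2 : IsConserved (exclK k) (fun s => ξ (wedgeInr 1 0 s))) :
    IsConserved (wedgeInteraction (exclK 1) (exclK k) (1 : Fin 2) (0 : Fin (k+1))) ξ := by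
  rintro q (⟨r, hr, rfl⟩ | ⟨r, hr, rfl⟩ | ⟨s, s', rfl⟩ | ⟨s, s', rfl⟩)
  · exact h1 r hr
  · exact h2 r hr
  · exact add_comm _ _
  · exact add_comm _ _

theorem wedge_lift {k : ℕ} {p q : Fin (k+1) × Fin (k+1)} (h : graphConn (exclK k) p q) :
    graphConn (wedgeInteraction (exclK 1) (exclK k) (1 : Fin 2) (0 : Fin (k+1)))
      (wedgeInr 1 0 p.1, wedgeInr 1 0 p.2) (wedgeInr 1 0 q.1, wedgeInr 1 0 q.2) :=
  rtg_lift (fun p : Fin (k+1) × Fin (k+1) =>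
    ((wedgeInr 1 0 p.1 : WS k), (wedgeInr 1 0 p.2 : WS k)))
    (fun a b hab => Or.inr (Or.inl ⟨(a, b), hab, rfl⟩)) h

theorem wedge_exch (k : ℕ) : ExchangeableInteraction
    (wedgeInteraction (exclK 1) (exclK k) (1 : Fin 2) (0 : Fin (k+1))) := by
  intro s1 s2
  rcases ws_cases s1 with rfl | ⟨j, rfl⟩ <;> rcases ws_cases s2 with rfl | ⟨l, rfl⟩
  · exact Relation.ReflTransGen.refl
  · exact Relation.ReflTransGen.single (Or.inr (Or.inr (Or.inl ⟨_, _, rfl⟩)))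
  · exact Relation.ReflTransGen.single (Or.inr (Or.inr (Or.inr ⟨_, _, rfl⟩)))
  · exact wedge_lift (exclK_exch k j l)

theorem wedge_IQ (k : ℕ) : IrreduciblyQuantified
    (wedgeInteraction (exclK 1) (exclK k) (1 : Fin 2) (0 : Fin (k+1))) := by
  classical
  intro X _ E hE hc η η' hcons
  have hnum := hcons (fun s => if wsNum k s = true then 1 else 0) (by
    apply wedge_cons
    · have : (fun s : Fin 2 => if wsNum k (wedgeInl 1 0 s) = true then (1:ℝ) else 0)
          = fun s : Fin (1+1) => ((s : ℕ) : ℝ) := by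
        funext s
        fin_cases s <;> simp [wsNum, wedgeInl]
      rw [this]
      exact exclK_cons 1
    · intro p _
      simp [wsNum, wedgeInr])
  obtain ⟨σ, hσ⟩ := exists_perm (fun x => wsNum k (η x)) (fun x => wsNum k (η' x)) (by
    intro t
    cases t
    · have e : ∀ b : Bool, (if b = false then (1:ℝ) else 0) = 1 - if b = true then 1 else 0 := by
        intro b; cases b <;> simp
      simp only [e, Finset.sum_sub_distrib, hnum]
    · exact hnum)
  have hen := hcons (fun s => ((wsEn k s : ℕ) : ℝ)) (by
    apply wedge_cons
    · intro p _
      simp [wsEn, wedgeInl]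
    · exact exclK_cons k)
  refine (permConn _ E (wedge_exch k) hc σ η).trans ?_
  have hen' : ∑ x, wsEn k ((η ∘ σ) x) = ∑ x, wsEn k (η' x) := by
    have : ∑ x, wsEn k ((η ∘ σ) x) = ∑ x, wsEn k (η x) :=
      Equiv.sum_comp σ (fun x => wsEn k (η x))
    rw [this]
    exact_mod_cast hen
  have hnum' : ∀ x, wsNum k ((η ∘ σ) x) = wsNum k (η' x) := fun x => congrFun hσ x
  generalize η ∘ σ = ζ at hen' hnum'
  let A := {x : X // wsNum k (η' x) = true}
  let g : (A → Unit → Fin (k+1)) → X → WS k := fun f x =>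
    if h : wsNum k (η' x) = true then wedgeInr 1 0 (f ⟨x, h⟩ ()) else wedgeInl 1 0 0
  have hsurj : ∀ θ : X → WS k, (∀ x, wsNum k (θ x) = wsNum k (η' x)) → ∃ f, g f = θ := by
    intro θ hθ
    have : ∀ a : A, ∃ j, θ a.1 = wedgeInr 1 0 j := by
      rintro ⟨x, hx⟩
      rcases ws_cases (θ x) with h | h
      · rw [← hθ x, h] at hx
        simp [wsNum, wedgeInl] at hx
      · exact h
    choose f hf using this
    refine ⟨fun a _ => f a, ?_⟩
    funext x
    simp only [g]
    split_ifs with h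
    · exact (hf ⟨x, h⟩).symm
    · rcases ws_cases (θ x) with h' | ⟨j, h'⟩
      · exact h'.symm
      · rw [← hθ x, h'] at h
        simp [wsNum, wedgeInr] at h
  have hsum : ∀ f, ∑ x, wsEn k (g f x) = ∑ a : A, (f a () : ℕ) := by
    intro f
    rw [← Fintype.sum_subtype_add_sum_subtype (fun x => wsNum k (η' x) = true)
      (fun x => wsEn k (g f x))]
    have z2 : ∑ i : {x // ¬ wsNum k (η' x) = true}, wsEn k (g f i) = 0 := by
      apply Finset.sum_eq_zero
      rintro ⟨x, hx⟩ _
      simp only [g, dif_neg hx]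
      rfl
    rw [z2, add_zero]
    apply Finset.sum_congr rfl
    rintro ⟨x, hx⟩ _
    simp only [g, dif_pos hx]
    rfl
  obtain ⟨f, rfl⟩ := hsurj ζ hnum'
  obtain ⟨f', hf'⟩ := hsurj η' (fun _ => rfl)
  rw [← hf']
  refine transfer_lem k (fun f f' => configConn _ E (g f) (g f'))
    (fun _ => Relation.ReflTransGen.refl) (fun a b c h1 h2 => h1.trans h2) ?_ f f' ?_
  · rintro a b ⟨x, hx⟩ ⟨y, hy⟩ i hxy ho h1 h2
    have hxy' : x ≠ y := fun h => hxy (Subtype.ext h)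
    refine pairMove _ E (wedge_exch k) (hc x y) hxy' _ _ ?_ ?_
    · intro z hz1 hz2
      simp only [g]
      split_ifs with hz
      · have := ho ⟨z, hz⟩ ()
        rcases this with h | h | h
        · exact absurd (congrArg Subtype.val h.1) hz1
        · exact absurd (congrArg Subtype.val h.1) hz2
        · rw [h]
      · rfl
    · simp only [g, hx, hy, dif_pos]
      exact wedge_lift (p := (_, _)) (q := (_, _))
        (Relation.ReflTransGen.single (exclK_mem _ _ _ _ h1 h2).1)
  · rintro ⟨⟩
    rw [← hsum, ← hsum, hf', hen']

/-- the `κ`-exclusion, multi-species exclusion, lattice gas with energy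
(wedge sum `φ_EX ∨ φ_{(κ-1)-EX}` along `1 ∈ {0,1}` and `0 ∈ {0,…,κ-1}`), and `N`-lane
`κ`-exclusion interactions are all irreducibly quantified. -/
theorem stmt18 (κ N : ℕ) (hκ : 1 ≤ κ) (hN : 1 ≤ N) :
    IrreduciblyQuantified (exclK κ) ∧
    IrreduciblyQuantified (msExcl κ) ∧
    IrreduciblyQuantified
      (wedgeInteraction (exclK 1) (exclK (κ - 1)) (1 : Fin 2) (0 : Fin (κ - 1 + 1))) ∧
    IrreduciblyQuantified (nLane κ N) := by
  exact ⟨exclK_IQ κ, msExcl_IQ κ, wedge_IQ (κ - 1), nLane_IQ κ N⟩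
end
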